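/- arXiv:2106.14665 — 2 statements merged into one kernel-verified Lean document; each statement's English description precedes it below -/
import Mathlib

section
/- Let t, u, d be integers with t and u relatively prime, d > 0, and d dividing t² + 6·u². Then there exist integers y and z such that either d = y² + 6·z² or d = 2·y² + 3·z². -/
/-- The binary form `a X² + 2 b X Y + c Y²` is obtained by substitution from one of the two
reduced forms `X² + 6 Y²`, `2 X² + 3 Y²`. -/
def FormRep (a b c : ℤ) : Prop :=
  ∃ p q r s : ℤ,
    (a = p ^ 2 + 6 * r ^ 2 ∧ b = p * q + 6 * r * s ∧ c = q ^ 2 + 6 * s ^ 2) ∨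
    (a = 2 * p ^ 2 + 3 * r ^ 2 ∧ b = 2 * p * q + 3 * r * s ∧ c = 2 * q ^ 2 + 3 * s ^ 2)

theorem FormRep.swap {a b c : ℤ} (h : FormRep a b c) : FormRep c b a := by
  obtain ⟨p, q, r, s, ⟨h1, h2, h3⟩ | ⟨h1, h2, h3⟩⟩ := h
  · exact ⟨q, p, s, r, Or.inl ⟨h3, by rw [h2]; ring, h1⟩⟩
  · exact ⟨q, p, s, r, Or.inr ⟨h3, by rw [h2]; ring, h1⟩⟩

theorem FormRep.shift {a b c : ℤ} (k : ℤ)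
    (h : FormRep a (b + k * a) (c + 2 * k * b + k ^ 2 * a)) : FormRep a b c := by
  obtain ⟨p, q, r, s, ⟨h1, h2, h3⟩ | ⟨h1, h2, h3⟩⟩ := h
  · refine ⟨p, q - k * p, r, s - k * r, Or.inl ⟨h1, ?_, ?_⟩⟩
    · linear_combination h2 - k * h1
    · linear_combination h3 - 2 * k * h2 + k ^ 2 * h1
  · refine ⟨p, q - k * p, r, s - k * r, Or.inr ⟨h1, ?_, ?_⟩⟩
    · linear_combination h2 - k * h1
    · linear_combination h3 - 2 * k * h2 + k ^ 2 * h1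

theorem formRep_of_disc (n : ℕ) : ∀ a b c : ℤ, b.natAbs = n → 0 < a → 0 < c →
    a * c = b ^ 2 + 6 → FormRep a b c := by
  induction n using Nat.strong_induction_on with
  | _ n ih =>
    have step : ∀ a b c : ℤ, b.natAbs = n → 0 < a → 0 < c →
        a * c = b ^ 2 + 6 → a < 2 * |b| → FormRep a b c := by
      intro a b c hb ha hc h hlt
      have key : ∀ k : ℤ, (b + k * a).natAbs < n → FormRep a b c := by
        intro k hk
        have h' : a * (c + 2 * k * b + k ^ 2 * a) = (b + k * a) ^ 2 + 6 := by
          linear_combination h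
        refine FormRep.shift k (ih _ hk _ _ _ rfl ha ?_ h')
        refine pos_of_mul_pos_right (a := a) ?_ ha.le
        rw [h']; positivity
      rcases le_total 0 b with h0 | h0
      · rw [abs_of_nonneg h0] at hlt
        exact key (-1) (by omega)
      · rw [abs_of_nonpos h0] at hlt
        exact key 1 (by omega)
    intro a b c hb ha hc h
    by_cases h1 : a < 2 * |b|
    · exact step a b c hb ha hc h h1
    by_cases h2 : c < 2 * |b|
    · exact (step c b a hb hc ha (by linarith) h2).swap
    push Not at h1 h2
    have hb0 := abs_nonneg b
    have hsq := sq_abs b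
    have hlt : |b| < 2 := by nlinarith
    have ha6 : a ≤ 7 := by nlinarith
    obtain ⟨hb1, hb2⟩ := abs_lt.mp hlt
    have hb3 : b = -1 ∨ b = 0 ∨ b = 1 := by omega
    rcases hb3 with rfl | rfl | rfl
    · norm_num at h1 h2 h
      interval_cases a <;> omega
    · norm_num at h
      have hcases : (a = 1 ∧ c = 6) ∨ (a = 2 ∧ c = 3) ∨ (a = 3 ∧ c = 2) ∨ (a = 6 ∧ c = 1) := by
        interval_cases a <;> omega
      rcases hcases with ⟨rfl, rfl⟩ | ⟨rfl, rfl⟩ | ⟨rfl, rfl⟩ | ⟨rfl, rfl⟩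
      · exact ⟨1, 0, 0, 1, by norm_num⟩
      · exact ⟨1, 0, 0, 1, by norm_num⟩
      · exact ⟨0, 1, 1, 0, by norm_num⟩
      · exact ⟨0, 1, 1, 0, by norm_num⟩
    · norm_num at h1 h2 h
      interval_cases a <;> omega

theorem stmt_10 (t u d : ℤ) (hcop : IsCoprime t u) (hd : d > 0)
    (hdvd : d ∣ t ^ 2 + 6 * u ^ 2) :
    ∃ y z : ℤ, d = y ^ 2 + 6 * z ^ 2 ∨ d = 2 * y ^ 2 + 3 * z ^ 2 := by
  obtain ⟨k, hk⟩ := hdvd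
  have hud : IsCoprime u d := by
    have h1 : IsCoprime u (t ^ 2) := hcop.symm.pow_right
    have h2 : IsCoprime u (d * k) := by
      rw [← hk]
      have := h1.add_mul_left_right (6 * u)
      have he : t ^ 2 + 6 * u ^ 2 = t ^ 2 + u * (6 * u) := by ring
      rw [he]
      exact this
    exact h2.of_mul_right_left
  obtain ⟨v, w, hvw⟩ := hud
  -- `v` inverts `u` modulo `d`, so `(t v)² ≡ -6`
  have hm : d * (v ^ 2 * k + 6 * w * (1 + v * u)) = (t * v) ^ 2 + 6 := by
    linear_combination (-v ^ 2) * hk + 6 * (1 + v * u) * hvw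
  have hpos : 0 < v ^ 2 * k + 6 * w * (1 + v * u) := by
    refine pos_of_mul_pos_right (a := d) ?_ hd.le
    rw [hm]; positivity
  obtain ⟨p, q, r, s, ⟨h1, -, -⟩ | ⟨h1, -, -⟩⟩ := formRep_of_disc _ _ _ _ rfl hd hpos hm
  · exact ⟨p, r, Or.inl h1⟩
  · exact ⟨p, r, Or.inr h1⟩
end

section
/- Let t, u, d be integers with t and u relatively prime, d odd, and d dividing t² − 2·u². Then there exist integers y and z such that d = y² − 2·z². -/
theorem form_aux (n : ℕ) : ∀ a b c : ℤ, a.natAbs ≤ n → b ^ 2 - a * c = 2 →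
    ∃ p q r s : ℤ, a = p ^ 2 - 2 * r ^ 2 ∧ b = p * q - 2 * r * s ∧ c = q ^ 2 - 2 * s ^ 2 := by
  induction n with
  | zero =>
    intro a b c ha h
    have ha0 : a = 0 := by omega
    subst ha0
    exfalso
    have h1 : b < 2 := by nlinarith
    have h2 : -2 < b := by nlinarith
    interval_cases b <;> simp at h
  | succ n ih =>
    intro a b c ha h
    -- reduce b modulo a
    obtain ⟨k, hk1, hk2⟩ : ∃ k : ℤ, 2 * (b + k * a) ≤ |a| ∧ -|a| ≤ 2 * (b + k * a) := by
      rcases eq_or_ne a 0 with h0 | h0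
      · subst h0
        exfalso
        have h1 : b < 2 := by nlinarith
        have h2 : -2 < b := by nlinarith
        interval_cases b <;> simp at h
      · have hm := Int.emod_add_mul_ediv b a
        have h1 := Int.emod_nonneg b h0
        have h2 := Int.emod_lt_abs b h0
        by_cases h3 : 2 * (b % a) ≤ |a|
        · refine ⟨-(b / a), ?_, ?_⟩ <;> nlinarith
        · rcases abs_cases a with ⟨h4, h5⟩ | ⟨h4, h5⟩
          · refine ⟨-(b / a) - 1, ?_, ?_⟩ <;> nlinarith
          · refine ⟨-(b / a) + 1, ?_, ?_⟩ <;> nlinarith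
    obtain ⟨b', hb'⟩ : ∃ b', b' = b + k * a := ⟨_, rfl⟩
    obtain ⟨c', hc'⟩ : ∃ c', c' = c + 2 * k * b + k ^ 2 * a := ⟨_, rfl⟩
    rw [← hb'] at hk1 hk2
    have h' : b' ^ 2 - a * c' = 2 := by
      rw [hb', hc']; linear_combination h
    suffices hs : ∃ p q r s : ℤ, a = p ^ 2 - 2 * r ^ 2 ∧ b' = p * q - 2 * r * s ∧
        c' = q ^ 2 - 2 * s ^ 2 by
      obtain ⟨p, q, r, s, e1, e2, e3⟩ := hs
      have hb : b = b' - k * a := by rw [hb']; ring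
      have hc : c = c' - 2 * k * b' + k ^ 2 * a := by rw [hc', hb']; ring
      refine ⟨p, q - k * p, r, s - k * r, e1, ?_, ?_⟩
      · rw [hb, e1, e2]; ring
      · rw [hc, e1, e2, e3]; ring
    by_cases hlt : c'.natAbs ≤ n
    · obtain ⟨p, q, r, s, e1, e2, e3⟩ := ih c' b' a hlt (by linear_combination h')
      exact ⟨q, p, s, r, e3, by rw [e2]; ring, e1⟩
    · have hca : |a| ≤ |c'| := by
        rw [Int.abs_eq_natAbs, Int.abs_eq_natAbs]; omega
      have hprod : |a| * |c'| = |b' ^ 2 - 2| := by rw [← abs_mul]; congr 1; linarith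
      have hb2 : 4 * b' ^ 2 ≤ |a| ^ 2 := by nlinarith
      have ha2 : |a| < 2 := by
        by_contra hge
        push Not at hge
        have : |a| * |a| ≤ |a| * |c'| := mul_le_mul_of_nonneg_left hca (abs_nonneg a)
        rcases abs_cases (b' ^ 2 - 2) with ⟨h4, h5⟩ | ⟨h4, h5⟩ <;> nlinarith [sq_nonneg b']
      have hb0 : b' = 0 := by omega
      subst hb0
      have : a = 0 ∨ a = 1 ∨ a = -1 := by
        rw [abs_lt] at ha2; omega
      rcases this with rfl | rfl | rfl
      · simp at h'
      · exact ⟨1, 0, 0, 1, by norm_num, by norm_num, by linarith⟩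
      · exact ⟨1, 2, 1, 1, by norm_num, by norm_num, by linarith⟩

theorem main_aux (t u d : ℤ) (h : IsCoprime t u) (hd : d ∣ t ^ 2 - 2 * u ^ 2) :
    ∃ y z : ℤ, d = y ^ 2 - 2 * z ^ 2 := by
  have h1 : IsCoprime (t ^ 2 - 2 * u ^ 2) u := by
    have h2 : IsCoprime (t ^ 2) u := h.pow_left
    have h3 := h2.add_mul_left_left (-2 * u)
    have h4 : t ^ 2 - 2 * u ^ 2 = t ^ 2 + u * (-2 * u) := by ring
    rw [h4]; exact h3
  obtain ⟨y, x, hxy⟩ := h1.of_isCoprime_of_dvd_left hd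
  obtain ⟨w, hw⟩ := hd
  obtain ⟨p, q, r, s, e, -, -⟩ := form_aux d.natAbs d (t * x)
    (x ^ 2 * w - 4 * y + 2 * y ^ 2 * d) le_rfl (by
      have hx : x * u = 1 - y * d := by linarith
      have : t ^ 2 = d * w + 2 * u ^ 2 := by linarith
      have e2 : (t * x) ^ 2 = x ^ 2 * (d * w) + 2 * (x * u) ^ 2 := by
        rw [mul_pow, this]; ring
      rw [e2, hx]; ring)
  exact ⟨p, r, e⟩

theorem stmt_15 (t u d : ℤ) (hcop : IsCoprime t u)
    (hodd : ¬ (2 ∣ d)) (hdvd : d ∣ t ^ 2 - 2 * u ^ 2) :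
    ∃ y z : ℤ, d = y ^ 2 - 2 * z ^ 2 := by
  exact main_aux t u d (by assumption) (by assumption)
end
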